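/- Let ν, ρ > 0. Let u, m : (0,∞) × ℝ^d → ℝ be smooth functions, 2π-periodic in each spatial coordinate, with m > 0 and ∫_{[0,2π]^d} m(t,x) dx = 1 for all t > 0. Let ψ : (0,∞) × ℝ^d → ℝ be continuous and 2π-periodic in x, and let G : (0,∞) → ℝ be differentiable with G'(t) = ∫_{[0,2π]^d} ψ(t,x) ∂_t m(t,x) dx. Suppose the mean-field game system holds on (0,∞) × ℝ^d: −∂_t u + ρ u − ν Δu + ½|∇u|² = ψ and ∂_t m = ν Δm + ∇·(m ∇u). Define q = u + ν log m, 𝓠(t) = ∫_{[0,2π]^d} |∇q(t,x)|² m(t,x) dx, and 𝓔(t) = ρν ∫ m log m dx + (ν²/2) ∫ |∇m|²/m dx + G(t). Then the Lyapunov functional 𝓛(t) = 𝓔(t) − ½𝓠(t) satisfies d𝓛/dt = −ρ 𝓠(t) ≤ 0 for all t > 0. -/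

import Mathlib

open Real MeasureTheory

/-- Partial derivative of `f : ℝ^d → ℝ` in the `i`-th coordinate direction. -/
noncomputable def pd {d : ℕ} (f : (Fin d → ℝ) → ℝ) (i : Fin d) (x : Fin d → ℝ) : ℝ :=
  fderiv ℝ f x (Pi.single i 1)

/-- The fundamental cube `[0,2π]^d` of the torus `𝕋^d = (ℝ/2πℤ)^d`. -/
noncomputable def torusBox (d : ℕ) : Set (Fin d → ℝ) :=
  Set.Icc 0 (fun _ => 2 * π)

/-- The corrector term `𝓠(t) = ∫ |∇q(t,x)|² m(t,x) dx`, where `q = u + ν log m`. -/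
noncomputable def lyapQ (d : ℕ) (ν : ℝ) (u m : ℝ → (Fin d → ℝ) → ℝ) (t : ℝ) : ℝ :=
  ∫ x in torusBox d,
    (∑ i, (pd (fun y => u t y + ν * Real.log (m t y)) i x) ^ 2) * m t x

/-- The generalized free energy
`𝓔(t) = ρν Ent(m(t,·)) + (ν²/2) I(m(t,·)) + G(t)`. -/
noncomputable def lyapE (d : ℕ) (ν ρ : ℝ) (m : ℝ → (Fin d → ℝ) → ℝ) (G : ℝ → ℝ)
    (t : ℝ) : ℝ :=
  ρ * ν * (∫ x in torusBox d, m t x * Real.log (m t x)) +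
    (ν ^ 2 / 2) * (∫ x in torusBox d, (∑ i, (pd (m t) i x) ^ 2) / m t x) + G t

open scoped ContDiff

namespace Lyap

variable {d : ℕ}

abbrev Om (d : ℕ) : Set (ℝ × (Fin d → ℝ)) := Set.Ioi (0:ℝ) ×ˢ Set.univ

lemma isOpen_Om : IsOpen (Om d) := isOpen_Ioi.prod isOpen_univ

abbrev Sm (f : ℝ × (Fin d → ℝ) → ℝ) : Prop := ContDiffOn ℝ (⊤ : ℕ∞) f (Om d)

def Per (f : ℝ × (Fin d → ℝ) → ℝ) : Prop :=
  ∀ p ∈ Om d, ∀ i : Fin d, f (p + (0, Pi.single i (2 * π))) = f p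

noncomputable def D (v : ℝ × (Fin d → ℝ)) (f : ℝ × (Fin d → ℝ) → ℝ) (p : ℝ × (Fin d → ℝ)) : ℝ :=
  fderiv ℝ f p v

def e (i : Fin d) : ℝ × (Fin d → ℝ) := (0, Pi.single i 1)
def τ : ℝ × (Fin d → ℝ) := (1, 0)

variable {f g : ℝ × (Fin d → ℝ) → ℝ} {p : ℝ × (Fin d → ℝ)} {v w : ℝ × (Fin d → ℝ)}

lemma Sm.at (hf : Sm f) (hp : p ∈ Om d) : ContDiffAt ℝ (⊤ : ℕ∞) f p :=
  hf.contDiffAt (isOpen_Om.mem_nhds hp)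

lemma Sm.diff (hf : Sm f) (hp : p ∈ Om d) : DifferentiableAt ℝ f p :=
  (Sm.at hf hp).differentiableAt (by simp)

lemma Sm.D (hf : Sm f) : Sm (D v f) := by
  have h := hf.fderiv_of_isOpen (m := (⊤ : ℕ∞)) isOpen_Om (by simp)
  exact h.clm_apply contDiffOn_const

lemma D_add (hf : Sm f) (hg : Sm g) (hp : p ∈ Om d) :
    D v (fun p => f p + g p) p = D v f p + D v g p := by
  simp [D, fderiv_fun_add (Sm.diff hf hp) (Sm.diff hg hp)]

lemma D_sub (hf : Sm f) (hg : Sm g) (hp : p ∈ Om d) :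
    D v (fun p => f p - g p) p = D v f p - D v g p := by
  simp [D, fderiv_fun_sub (Sm.diff hf hp) (Sm.diff hg hp)]

lemma D_mul (hf : Sm f) (hg : Sm g) (hp : p ∈ Om d) :
    D v (fun p => f p * g p) p = D v f p * g p + f p * D v g p := by
  simp [D, fderiv_fun_mul (Sm.diff hf hp) (Sm.diff hg hp)]; ring

lemma D_cmul (c : ℝ) (hf : Sm f) (hp : p ∈ Om d) :
    D v (fun p => c * f p) p = c * D v f p := by
  simp [D, fderiv_const_mul (Sm.diff hf hp)]

lemma D_addc (c : ℝ) : D v (fun p => f p + c) p = D v f p := by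
  simp [D]

lemma D_sq (hf : Sm f) (hp : p ∈ Om d) :
    D v (fun p => f p ^ 2) p = 2 * f p * D v f p := by
  simp only [pow_two]
  rw [D_mul hf hf hp]; ring

lemma D_sum {F : Fin d → ℝ × (Fin d → ℝ) → ℝ} (hf : ∀ i, Sm (F i)) (hp : p ∈ Om d) :
    D v (fun p => ∑ i, F i p) p = ∑ i, D v (F i) p := by
  simp only [D]
  rw [fderiv_fun_sum (fun i _ => Sm.diff (hf i) hp)]
  simp

lemma D_log (hf : Sm f) (hpos : ∀ p ∈ Om d, 0 < f p) (hp : p ∈ Om d) :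
    D v (fun p => Real.log (f p)) p = D v f p / f p := by
  simp only [D]
  rw [fderiv.log (Sm.diff hf hp) (hpos p hp).ne']
  simp; field_simp

lemma D_comm (hf : Sm f) (hp : p ∈ Om d) : D v (D w f) p = D w (D v f) p := by
  have h2 : DifferentiableAt ℝ (fderiv ℝ f) p :=
    ((hf.fderiv_of_isOpen (m := (⊤ : ℕ∞)) isOpen_Om (by simp)).contDiffAt
      (isOpen_Om.mem_nhds hp)).differentiableAt (by simp)
  have hs : IsSymmSndFDerivAt ℝ f p := (Sm.at hf hp).isSymmSndFDerivAt (by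
    simp only [minSmoothness_of_isRCLikeNormedField]; exact WithTop.coe_le_coe.2 (le_top : (2 : ℕ∞) ≤ ⊤))
  have key : ∀ a b, D a (D b f) p = fderiv ℝ (fderiv ℝ f) p a b := by
    intro a b
    have : D b f = fun q => fderiv ℝ f q b := rfl
    rw [this]
    simp only [D]
    rw [fderiv_clm_apply h2 (by fun_prop)]
    simp
  rw [key, key]; exact hs v w

lemma pd_eq {t : ℝ} (ht : 0 < t) (hf : Sm f) (i : Fin d) (x : Fin d → ℝ) :
    pd (fun y => f (t, y)) i x = D (e i) f (t, x) := by
  have hd := (Sm.diff hf (p := (t, x)) ⟨ht, trivial⟩).hasFDerivAt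
  have h2 : HasFDerivAt (fun y : Fin d → ℝ => (t, y)) (ContinuousLinearMap.inr ℝ ℝ (Fin d → ℝ)) x :=
    hasFDerivAt_prodMk_right t x
  have := (hd.comp x h2).fderiv
  simp only [pd, D, e]
  simp only [Function.comp_def] at this
  rw [this]; simp

lemma hasDerivAt_t {t : ℝ} (ht : 0 < t) (hf : Sm f) (x : Fin d → ℝ) :
    HasDerivAt (fun s => f (s, x)) (D τ f (t, x)) t := by
  have hd := (Sm.diff hf (p := (t, x)) ⟨ht, trivial⟩).hasFDerivAt
  have h2 : HasDerivAt (fun s : ℝ => (s, x)) ((1:ℝ), (0 : Fin d → ℝ)) t :=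
    (hasDerivAt_id t).prodMk (hasDerivAt_const t x)
  exact hd.comp_hasDerivAt t h2

lemma Per.D (hf : Per f) : Per (D v f) := by
  intro p hp i
  simp only [Lyap.D]
  rw [← fderiv_comp_add_right]
  congr 1
  apply Filter.EventuallyEq.fderiv_eq
  filter_upwards [isOpen_Om.mem_nhds hp] with q hq
  exact hf q hq i

lemma Sm.cont {t : ℝ} (ht : 0 < t) (hf : Sm f) : Continuous (fun x => f (t, x)) :=
  hf.continuousOn.comp_continuous (by fun_prop) (fun x => ⟨ht, trivial⟩)

lemma intOn {h : (Fin d → ℝ) → ℝ} (hh : Continuous h) : IntegrableOn h (torusBox d) :=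
  hh.continuousOn.integrableOn_compact isCompact_Icc

lemma div_zero' {t : ℝ} (ht : 0 < t) {W : Fin d → ℝ × (Fin d → ℝ) → ℝ}
    (hW : ∀ i, Sm (W i)) (hP : ∀ i, Per (W i)) :
    ∫ x in torusBox d, ∑ i, D (e i) (W i) (t, x) = 0 := by
  cases d with
  | zero => simp
  | succ n =>
    have hle : (0 : Fin (n+1) → ℝ) ≤ (fun _ => 2 * π) := fun i => by
      simp; positivity
    have hD : ∀ x i, HasFDerivAt (fun y => W i (t, y))
        ((fderiv ℝ (W i) (t, x)).comp (ContinuousLinearMap.inr ℝ ℝ (Fin (n+1) → ℝ))) x := by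
      intro x i
      exact ((Sm.diff (hW i) (p := (t, x)) ⟨ht, trivial⟩).hasFDerivAt).comp x
        (hasFDerivAt_prodMk_right t x)
    have := integral_divergence_of_hasFDerivAt_off_countable' (0 : Fin (n+1) → ℝ) (fun _ => 2 * π) hle
      (fun i y => W i (t, y))
      (fun i x => (fderiv ℝ (W i) (t, x)).comp (ContinuousLinearMap.inr ℝ ℝ (Fin (n+1) → ℝ)))
      ∅ Set.countable_empty
      (fun i => (Sm.cont ht (hW i)).continuousOn)
      (fun x _ i => hD x i)
      (by
        apply intOn
        apply continuous_finsetSum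
        intro i _
        have := Sm.cont ht (Sm.D (v := e i) (hW i))
        simpa [D, e] using this)
    have h3 : ∀ x, ∑ i, D (e i) (W i) (t, x) = ∑ i, ((fderiv ℝ (W i) (t, x)).comp (ContinuousLinearMap.inr ℝ ℝ (Fin (n+1) → ℝ))) (Pi.single i 1) := by
      intro x; simp [D, e]
    simp only [h3]
    unfold torusBox
    rw [this]
    apply Finset.sum_eq_zero
    intro i _
    rw [sub_eq_zero]
    congr 1
    funext x
    rw [← hP i (t, i.insertNth ((0 : Fin (n+1) → ℝ) i) x) ⟨ht, trivial⟩ i]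
    congr 1
    ext j
    · simp
    · refine Fin.succAboveCases i ?_ ?_ j <;> simp

lemma deriv_int {t : ℝ} (ht : 0 < t) (hf : Sm f) :
    HasDerivAt (fun s => ∫ x in torusBox d, f (s, x)) (∫ x in torusBox d, D τ f (t, x)) t := by
  have hc : ContinuousOn (D τ f) (Set.Icc (t/2) (2*t) ×ˢ torusBox d) :=
    (Sm.D hf).continuousOn.mono (fun q hq => ⟨lt_of_lt_of_le (by positivity) hq.1.1, trivial⟩)
  obtain ⟨C, hC⟩ := (isCompact_Icc.prod isCompact_Icc).exists_bound_of_continuousOn hc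
  have hn : Set.Icc (t/2) (2*t) ∈ nhds t := Icc_mem_nhds (by linarith) (by linarith)
  refine (hasDerivAt_integral_of_dominated_loc_of_deriv_le (F := fun s x => f (s, x))
    (F' := fun s x => D τ f (s, x)) (bound := fun _ => C) hn ?_ (intOn (Sm.cont ht hf))
    ?_ ?_ ?_ ?_).2
  · filter_upwards [lt_mem_nhds ht] with s hs
    exact (Sm.cont hs hf).aestronglyMeasurable
  · exact (Sm.cont ht (Sm.D hf)).aestronglyMeasurable
  · filter_upwards [ae_restrict_mem measurableSet_Icc] with x hx s hs
    exact hC (s, x) ⟨hs, hx⟩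
  · exact intOn continuous_const
  · refine Filter.Eventually.of_forall fun x s hs => hasDerivAt_t ?_ hf x
    exact lt_of_lt_of_le (by positivity) hs.1

end Lyap
namespace Lyap
variable {d : ℕ}

lemma algebra_id (ν ρ M mt L U ut ψ : ℝ) (hM : 0 < M)
    (ui mi uti mti uii dF : Fin d → ℝ)
    (hF : mt = ∑ i, dF i)
    (hψ : ψ = -ut + ρ * U - ν * (∑ i, uii i) + 1/2 * ∑ i, ui i ^ 2) :
    (ρ * ν * (mt * L + mt) - (1/2) * ((∑ i, 2 * ui i * uti i) * M + (∑ i, ui i ^ 2) * mt)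
      - ν * ∑ i, (uti i * mi i + ui i * mti i)) + ψ * mt
    = - ρ * ((∑ i, (ui i + ν * (mi i / M)) ^ 2) * M)
      + ∑ i, (((ρ * (ui i + ν * (mi i / M)) - uti i) * (M * ui i + ν * mi i)
        + (ρ * (U + ν * L + ν) - ut) * dF i) - ν * (mti i * ui i + mt * uii i)) := by
  have h1 : - ρ * ((∑ i, (ui i + ν * (mi i / M)) ^ 2) * M)
      + ∑ i, (((ρ * (ui i + ν * (mi i / M)) - uti i) * (M * ui i + ν * mi i)
        + (ρ * (U + ν * L + ν) - ut) * dF i) - ν * (mti i * ui i + mt * uii i))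
      = (ρ * (U + ν * L + ν) - ut) * (∑ i, dF i) - M * (∑ i, ui i * uti i)
        - ν * (∑ i, uti i * mi i) - ν * (∑ i, ui i * mti i) - ν * mt * ∑ i, uii i := by
    simp only [Finset.mul_sum, Finset.sum_mul, ← Finset.sum_add_distrib, ← Finset.sum_sub_distrib]
    apply Finset.sum_congr rfl
    intro i _
    field_simp
    ring
  have h2 : (∑ i, 2 * ui i * uti i) = 2 * ∑ i, ui i * uti i := by
    simp only [Finset.mul_sum, mul_assoc]
  rw [h1, ← hF, h2, hψ, Finset.sum_add_distrib]
  ring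

end Lyap

/-- Along a solution `(u,m)` of the time-dependent mean-field game
system on `(0,∞) × 𝕋^d`, the functional `𝓛 = 𝓔 − ½𝓠` is a Lyapunov functional:
`d𝓛/dt = −ρ𝓠(t) ≤ 0`. -/
theorem lyapunov_functional (d : ℕ) (ν ρ : ℝ) (hν : 0 < ν) (hρ : 0 < ρ)
    (u m : ℝ → (Fin d → ℝ) → ℝ)
    (hu : ContDiffOn ℝ (⊤ : ℕ∞) (fun p : ℝ × (Fin d → ℝ) => u p.1 p.2)
      (Set.Ioi (0:ℝ) ×ˢ Set.univ))
    (hm : ContDiffOn ℝ (⊤ : ℕ∞) (fun p : ℝ × (Fin d → ℝ) => m p.1 p.2)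
      (Set.Ioi (0:ℝ) ×ˢ Set.univ))
    (huper : ∀ t > (0:ℝ), ∀ (x : Fin d → ℝ) (i : Fin d),
      u t (x + Pi.single i (2 * π)) = u t x)
    (hmper : ∀ t > (0:ℝ), ∀ (x : Fin d → ℝ) (i : Fin d),
      m t (x + Pi.single i (2 * π)) = m t x)
    (hmpos : ∀ t > (0:ℝ), ∀ x, 0 < m t x)
    (hmass : ∀ t > (0:ℝ), (∫ x in torusBox d, m t x) = 1)
    (ψ : ℝ → (Fin d → ℝ) → ℝ)
    (hψ : ContinuousOn (fun p : ℝ × (Fin d → ℝ) => ψ p.1 p.2)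
      (Set.Ioi (0:ℝ) ×ˢ Set.univ))
    (hψper : ∀ t > (0:ℝ), ∀ (x : Fin d → ℝ) (i : Fin d),
      ψ t (x + Pi.single i (2 * π)) = ψ t x)
    (G : ℝ → ℝ)
    (hG : ∀ t > (0:ℝ), HasDerivAt G
      (∫ x in torusBox d, ψ t x * deriv (fun s => m s x) t) t)
    (hHJB : ∀ t > (0:ℝ), ∀ x,
      -(deriv (fun s => u s x) t) + ρ * u t x - ν * (∑ i, pd (pd (u t) i) i x) +
        (1 / 2) * (∑ i, (pd (u t) i x) ^ 2) = ψ t x)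
    (hFP : ∀ t > (0:ℝ), ∀ x,
      deriv (fun s => m s x) t = ν * (∑ i, pd (pd (m t) i) i x) +
        (∑ i, pd (fun y => m t y * pd (u t) i y) i x)) :
    ∀ t > (0:ℝ),
      HasDerivAt (fun s => lyapE d ν ρ m G s - (1 / 2) * lyapQ d ν u m s)
        (-ρ * lyapQ d ν u m t) t ∧
      -ρ * lyapQ d ν u m t ≤ 0 := by
  intro t ht
  refine ⟨?_, ?_⟩
  swap
  · have : 0 ≤ lyapQ d ν u m t := by
      unfold lyapQ
      apply integral_nonneg
      intro x
      exact mul_nonneg (Finset.sum_nonneg fun i _ => sq_nonneg _) (hmpos t ht x).le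
    nlinarith
  set U : ℝ × (Fin d → ℝ) → ℝ := fun p => u p.1 p.2 with hU
  set M : ℝ × (Fin d → ℝ) → ℝ := fun p => m p.1 p.2 with hM
  have su : Lyap.Sm U := hu
  have sm : Lyap.Sm M := hm
  have pu : Lyap.Per U := fun p hp i => by simpa [hU] using huper p.1 hp.1 p.2 i
  have pm : Lyap.Per M := fun p hp i => by simpa [hM] using hmper p.1 hp.1 p.2 i
  have Mpos : ∀ p ∈ Lyap.Om d, 0 < M p := fun p hp => hmpos p.1 hp.1 p.2
  have slog : Lyap.Sm (fun p => Real.log (M p)) := sm.log (fun p hp => (Mpos p hp).ne')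
  have plog : Lyap.Per (fun p => Real.log (M p)) := fun p hp i => by simp only [pm p hp i]
  have sui : ∀ i, Lyap.Sm (Lyap.D (Lyap.e i) U) := fun i => Lyap.Sm.D su
  have smi : ∀ i, Lyap.Sm (Lyap.D (Lyap.e i) M) := fun i => Lyap.Sm.D sm
  have sut : Lyap.Sm (Lyap.D Lyap.τ U) := Lyap.Sm.D su
  have smt : Lyap.Sm (Lyap.D Lyap.τ M) := Lyap.Sm.D sm
  have pui : ∀ i, Lyap.Per (Lyap.D (Lyap.e i) U) := fun i => Lyap.Per.D pu
  have pmi : ∀ i, Lyap.Per (Lyap.D (Lyap.e i) M) := fun i => Lyap.Per.D pm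
  have put : Lyap.Per (Lyap.D Lyap.τ U) := Lyap.Per.D pu
  have pmt : Lyap.Per (Lyap.D Lyap.τ M) := Lyap.Per.D pm
  have hpdu : ∀ s > 0, ∀ i x, pd (u s) i x = Lyap.D (Lyap.e i) U (s, x) :=
    fun s hs i x => Lyap.pd_eq hs su i x
  have hpdm : ∀ s > 0, ∀ i x, pd (m s) i x = Lyap.D (Lyap.e i) M (s, x) :=
    fun s hs i x => Lyap.pd_eq hs sm i x
  have smu : ∀ i, Lyap.Sm (fun p => M p * Lyap.D (Lyap.e i) U p) := fun i => sm.mul (sui i)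
  have snm : ∀ i, Lyap.Sm (fun p => ν * Lyap.D (Lyap.e i) M p) :=
    fun i => contDiffOn_const.mul (smi i)
  have sF : ∀ i, Lyap.Sm (fun p => M p * Lyap.D (Lyap.e i) U p + ν * Lyap.D (Lyap.e i) M p) :=
    fun i => (smu i).add (snm i)
  have snl : Lyap.Sm (fun p => ν * Real.log (M p)) := contDiffOn_const.mul slog
  have sq : Lyap.Sm (fun p => U p + ν * Real.log (M p)) := su.add snl
  have sqn : Lyap.Sm (fun p => U p + ν * Real.log (M p) + ν) := sq.add contDiffOn_const
  have srq : Lyap.Sm (fun p => ρ * (U p + ν * Real.log (M p) + ν)) := contDiffOn_const.mul sqn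
  have sA : Lyap.Sm (fun p => ρ * (U p + ν * Real.log (M p) + ν) - Lyap.D Lyap.τ U p) :=
    srq.sub sut
  have sAF : ∀ i, Lyap.Sm (fun p => (ρ * (U p + ν * Real.log (M p) + ν) - Lyap.D Lyap.τ U p) *
      (M p * Lyap.D (Lyap.e i) U p + ν * Lyap.D (Lyap.e i) M p)) := fun i => sA.mul (sF i)
  have smtu : ∀ i, Lyap.Sm (fun p => Lyap.D Lyap.τ M p * Lyap.D (Lyap.e i) U p) :=
    fun i => smt.mul (sui i)
  have snmtu : ∀ i, Lyap.Sm (fun p => ν * (Lyap.D Lyap.τ M p * Lyap.D (Lyap.e i) U p)) :=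
    fun i => contDiffOn_const.mul (smtu i)
  let W : Fin d → ℝ × (Fin d → ℝ) → ℝ := fun i p =>
    (ρ * (U p + ν * Real.log (M p) + ν) - Lyap.D Lyap.τ U p) *
      (M p * Lyap.D (Lyap.e i) U p + ν * Lyap.D (Lyap.e i) M p) -
      ν * (Lyap.D Lyap.τ M p * Lyap.D (Lyap.e i) U p)
  have sW : ∀ i, Lyap.Sm (W i) := fun i => (sAF i).sub (snmtu i)
  have pW : ∀ i, Lyap.Per (W i) := fun i p hp j => by
    simp only [W, pu p hp j, pm p hp j, pui i p hp j, pmi i p hp j, put p hp j, pmt p hp j]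
  have hDW : ∀ i, ∀ p ∈ Lyap.Om d, Lyap.D (Lyap.e i) (W i) p =
      (((ρ * (Lyap.D (Lyap.e i) U p + ν * (Lyap.D (Lyap.e i) M p / M p)) -
          Lyap.D Lyap.τ (Lyap.D (Lyap.e i) U) p) *
        (M p * Lyap.D (Lyap.e i) U p + ν * Lyap.D (Lyap.e i) M p)
        + (ρ * (U p + ν * Real.log (M p) + ν) - Lyap.D Lyap.τ U p) *
          Lyap.D (Lyap.e i) (fun p => M p * Lyap.D (Lyap.e i) U p + ν * Lyap.D (Lyap.e i) M p) p)
        - ν * (Lyap.D Lyap.τ (Lyap.D (Lyap.e i) M) p * Lyap.D (Lyap.e i) U p +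
          Lyap.D Lyap.τ M p * Lyap.D (Lyap.e i) (Lyap.D (Lyap.e i) U) p)) := by
    intro i p hp
    simp only [W]
    rw [Lyap.D_sub (sAF i) (snmtu i) hp, Lyap.D_mul sA (sF i) hp, Lyap.D_sub srq sut hp,
      Lyap.D_cmul ρ sqn hp, Lyap.D_addc, Lyap.D_add su snl hp, Lyap.D_cmul ν slog hp,
      Lyap.D_log sm Mpos hp, Lyap.D_cmul ν (smtu i) hp, Lyap.D_mul smt (sui i) hp,
      Lyap.D_comm (v := Lyap.e i) (w := Lyap.τ) su hp,
      Lyap.D_comm (v := Lyap.e i) (w := Lyap.τ) sm hp]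
  -- the reduced integrand
  have sml : Lyap.Sm (fun p => M p * Real.log (M p)) := sm.mul slog
  have srml : Lyap.Sm (fun p => ρ * ν * (M p * Real.log (M p))) := contDiffOn_const.mul sml
  have ssq : ∀ i, Lyap.Sm (fun p => Lyap.D (Lyap.e i) U p ^ 2) := fun i => (sui i).pow 2
  have sS : Lyap.Sm (fun p => ∑ i, Lyap.D (Lyap.e i) U p ^ 2) := ContDiffOn.sum fun i _ => ssq i
  have sSM : Lyap.Sm (fun p => (∑ i, Lyap.D (Lyap.e i) U p ^ 2) * M p) := sS.mul sm
  have shSM : Lyap.Sm (fun p => (1/2) * ((∑ i, Lyap.D (Lyap.e i) U p ^ 2) * M p)) :=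
    contDiffOn_const.mul sSM
  have sum' : ∀ i, Lyap.Sm (fun p => Lyap.D (Lyap.e i) U p * Lyap.D (Lyap.e i) M p) :=
    fun i => (sui i).mul (smi i)
  have sT : Lyap.Sm (fun p => ∑ i, Lyap.D (Lyap.e i) U p * Lyap.D (Lyap.e i) M p) :=
    ContDiffOn.sum fun i _ => sum' i
  have snT : Lyap.Sm (fun p => ν * ∑ i, Lyap.D (Lyap.e i) U p * Lyap.D (Lyap.e i) M p) :=
    contDiffOn_const.mul sT
  have sK1 : Lyap.Sm (fun p => ρ * ν * (M p * Real.log (M p)) -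
    (1/2) * ((∑ i, Lyap.D (Lyap.e i) U p ^ 2) * M p)) := srml.sub shSM
  let K : ℝ × (Fin d → ℝ) → ℝ := fun p => ρ * ν * (M p * Real.log (M p)) -
    (1/2) * ((∑ i, Lyap.D (Lyap.e i) U p ^ 2) * M p) -
    ν * ∑ i, Lyap.D (Lyap.e i) U p * Lyap.D (Lyap.e i) M p
  have sK : Lyap.Sm K := sK1.sub snT
  have hDK : ∀ p ∈ Lyap.Om d, Lyap.D Lyap.τ K p =
      ρ * ν * (Lyap.D Lyap.τ M p * Real.log (M p) + Lyap.D Lyap.τ M p) -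
      (1/2) * ((∑ i, 2 * Lyap.D (Lyap.e i) U p * Lyap.D Lyap.τ (Lyap.D (Lyap.e i) U) p) * M p
        + (∑ i, Lyap.D (Lyap.e i) U p ^ 2) * Lyap.D Lyap.τ M p)
      - ν * ∑ i, (Lyap.D Lyap.τ (Lyap.D (Lyap.e i) U) p * Lyap.D (Lyap.e i) M p +
        Lyap.D (Lyap.e i) U p * Lyap.D Lyap.τ (Lyap.D (Lyap.e i) M) p) := by
    intro p hp
    simp only [K]
    rw [Lyap.D_sub sK1 snT hp, Lyap.D_sub srml shSM hp, Lyap.D_cmul (ρ * ν) sml hp,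
      Lyap.D_mul sm slog hp, Lyap.D_log sm Mpos hp, Lyap.D_cmul (1/2) sSM hp, Lyap.D_mul sS sm hp,
      Lyap.D_sum ssq hp, Lyap.D_cmul ν sT hp, Lyap.D_sum sum' hp,
      mul_div_cancel₀ _ (Mpos p hp).ne']
    simp only [Lyap.D_sq (sui _) hp, Lyap.D_mul (sui _) (smi _) hp]
  -- Q integrand
  have hQ : ∀ s > 0, lyapQ d ν u m s = ∫ x in torusBox d,
      (∑ i, (Lyap.D (Lyap.e i) U (s, x) +
        ν * (Lyap.D (Lyap.e i) M (s, x) / M (s, x))) ^ 2) * M (s, x) := by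
    intro s hs
    unfold lyapQ
    congr 1
    funext x
    have hp : (s, x) ∈ Lyap.Om d := ⟨hs, trivial⟩
    congr 1
    refine Finset.sum_congr rfl fun i _ => ?_
    have := Lyap.pd_eq hs sq i x
    rw [Lyap.D_add su snl hp, Lyap.D_cmul ν slog hp, Lyap.D_log sm Mpos hp] at this
    rw [← this]
  have cQ : ∀ s > 0, Continuous (fun x => (∑ i, (Lyap.D (Lyap.e i) U (s, x) +
        ν * (Lyap.D (Lyap.e i) M (s, x) / M (s, x))) ^ 2) * M (s, x)) := by
    intro s hs
    have cm := Lyap.Sm.cont hs sm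
    refine Continuous.mul (continuous_finsetSum _ fun i _ => ?_) cm
    exact ((Lyap.Sm.cont hs (sui i)).add (continuous_const.mul
      ((Lyap.Sm.cont hs (smi i)).div cm fun x => (hmpos s hs x).ne'))).pow 2
  have cI : ∀ s > 0, Continuous (fun x => (∑ i, Lyap.D (Lyap.e i) M (s, x) ^ 2) / M (s, x)) := by
    intro s hs
    have cm := Lyap.Sm.cont hs sm
    exact (continuous_finsetSum _ fun i _ => (Lyap.Sm.cont hs (smi i)).pow 2).div cm
      fun x => (hmpos s hs x).ne'
  have hL : ∀ s > 0, lyapE d ν ρ m G s - (1 / 2) * lyapQ d ν u m s =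
      (∫ x in torusBox d, K (s, x)) + G s := by
    intro s hs
    rw [hQ s hs]
    unfold lyapE
    simp only [hpdm s hs]
    have i1 := Lyap.intOn (Lyap.Sm.cont hs sml)
    have i2 := Lyap.intOn (cI s hs)
    have i3 := Lyap.intOn (cQ s hs)
    have i12 : IntegrableOn (fun x => ρ * ν * (M (s, x) * Real.log (M (s, x))) +
        (ν ^ 2 / 2) * ((∑ i, Lyap.D (Lyap.e i) M (s, x) ^ 2) / M (s, x))) (torusBox d) :=
      (i1.const_mul _).add (i2.const_mul _)
    have : (∫ x in torusBox d, K (s, x)) =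
        ρ * ν * (∫ x in torusBox d, M (s, x) * Real.log (M (s, x))) +
        (ν ^ 2 / 2) * (∫ x in torusBox d, (∑ i, Lyap.D (Lyap.e i) M (s, x) ^ 2) / M (s, x)) -
        (1 / 2) * ∫ x in torusBox d, (∑ i, (Lyap.D (Lyap.e i) U (s, x) +
        ν * (Lyap.D (Lyap.e i) M (s, x) / M (s, x))) ^ 2) * M (s, x) := by
      rw [← integral_const_mul, ← integral_const_mul, ← integral_const_mul,
        ← integral_add (i1.const_mul _) (i2.const_mul _),
        ← integral_sub i12 (i3.const_mul _)]
      congr 1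
      funext x
      have h0 : M (s, x) ≠ 0 := (hmpos s hs x).ne'
      have : (ν ^ 2 / 2) * ((∑ i, Lyap.D (Lyap.e i) M (s, x) ^ 2) / M (s, x)) -
        (1 / 2) * ((∑ i, (Lyap.D (Lyap.e i) U (s, x) +
        ν * (Lyap.D (Lyap.e i) M (s, x) / M (s, x))) ^ 2) * M (s, x)) =
        - (1/2) * ((∑ i, Lyap.D (Lyap.e i) U (s, x) ^ 2) * M (s, x)) -
        ν * ∑ i, Lyap.D (Lyap.e i) U (s, x) * Lyap.D (Lyap.e i) M (s, x) := by
        simp only [Finset.mul_sum, Finset.sum_mul, Finset.sum_div, ← Finset.sum_sub_distrib]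
        refine Finset.sum_congr rfl fun i _ => ?_
        field_simp
        ring
      simp only [K]
      linarith
    rw [this]
    simp only [hM]
    ring
  have hder : HasDerivAt (fun s => (∫ x in torusBox d, K (s, x)) + G s)
      ((∫ x in torusBox d, Lyap.D Lyap.τ K (t, x)) +
        ∫ x in torusBox d, ψ t x * deriv (fun s => m s x) t) t :=
    (Lyap.deriv_int ht sK).add (hG t ht)
  have hval : ((∫ x in torusBox d, Lyap.D Lyap.τ K (t, x)) +
        ∫ x in torusBox d, ψ t x * deriv (fun s => m s x) t) = -ρ * lyapQ d ν u m t := by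
    have hmt : ∀ x, deriv (fun s => m s x) t = Lyap.D Lyap.τ M (t, x) :=
      fun x => (Lyap.hasDerivAt_t ht sm x).deriv
    have hut : ∀ x, deriv (fun s => u s x) t = Lyap.D Lyap.τ U (t, x) :=
      fun x => (Lyap.hasDerivAt_t ht su x).deriv
    have cψ : Continuous (fun x => ψ t x) :=
      hψ.comp_continuous (f := fun x => (t, x)) (by fun_prop) (fun x => ⟨ht, trivial⟩)
    have hdiv := Lyap.div_zero' ht sW pW
    rw [hQ t ht]
    simp only [hmt]
    have j1 := Lyap.intOn (Lyap.Sm.cont ht (Lyap.Sm.D (v := Lyap.τ) sK))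
    have j2 : IntegrableOn (fun x => ψ t x * Lyap.D Lyap.τ M (t, x)) (torusBox d) :=
      Lyap.intOn (cψ.mul (Lyap.Sm.cont ht smt))
    have j3 := Lyap.intOn (cQ t ht)
    have j4 := Lyap.intOn (continuous_finsetSum Finset.univ fun i _ =>
      Lyap.Sm.cont ht (Lyap.Sm.D (v := Lyap.e i) (sW i)))
    rw [← integral_add j1 j2, ← add_zero (-ρ * _), ← hdiv, ← integral_const_mul,
      ← integral_add (j3.const_mul _) j4]
    congr 1
    funext x
    have hp : (t, x) ∈ Lyap.Om d := ⟨ht, trivial⟩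
    simp only [hDK (t, x) hp, hDW _ (t, x) hp]
    have huf : ∀ i, pd (u t) i = fun y => Lyap.D (Lyap.e i) U (t, y) :=
      fun i => funext fun y => hpdu t ht i y
    have hmf : ∀ i, pd (m t) i = fun y => Lyap.D (Lyap.e i) M (t, y) :=
      fun i => funext fun y => hpdm t ht i y
    apply Lyap.algebra_id ν ρ _ _ _ _ _ _ (Mpos _ hp)
    · rw [← hmt, hFP t ht x, Finset.mul_sum, ← Finset.sum_add_distrib]
      refine Finset.sum_congr rfl fun i _ => ?_
      rw [Lyap.D_add (smu i) (snm i) hp, Lyap.D_cmul ν (smi i) hp, hmf, huf,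
        Lyap.pd_eq ht (smi i), ← Lyap.pd_eq ht (smu i)]
      ring
    · rw [← hHJB t ht x, hut]
      simp only [huf, Lyap.pd_eq ht (sui _)]
      rfl
  rw [← hval]
  refine hder.congr_of_eventuallyEq ?_
  filter_upwards [lt_mem_nhds ht] with s hs
  exact hL s hs
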